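/- arXiv:2309.01750 — 3 statements merged into one kernel-verified Lean document; each statement's English description precedes it below -/
import Mathlib

section
/- Let G be an undirected graph on a vertex set V with |V| = m having no isolated vertices, let 2 ≤ d ≤ m/2, and let Z ⊆ V with |Z| = d. Let N be the number of permutations π of V such that the permuted graph π(G) has no edge with one endpoint in Z and the other endpoint in V∖Z. Then N·binom(m, d) ≤ binom(⌊m/2⌋, ⌊d/2⌋)·m!. -/
section ClosedSets

variable {V : Type*} (G : SimpleGraph V)

/-- A finite set of vertices is closed under adjacency if no edge leaves it. -/
def SimpleGraph.IsAdjClosed (S : Finset V) : Prop :=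
  ∀ ⦃u v : V⦄, G.Adj u v → u ∈ S → v ∈ S

variable {G}

theorem SimpleGraph.IsAdjClosed.mem_of_reachable {S : Finset V} (hS : G.IsAdjClosed S) {u v : V}
    (h : G.Reachable u v) (hu : u ∈ S) : v ∈ S := by
  obtain ⟨p⟩ := h
  induction p with
  | nil => exact hu
  | cons hadj _ ih => exact ih (hS hadj hu)

open Classical in
theorem SimpleGraph.IsAdjClosed.subset_of_image_subset {S T : Finset V} (hT : G.IsAdjClosed T)
    (h : S.image G.connectedComponentMk ⊆ T.image G.connectedComponentMk) : S ⊆ T := by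
  intro v hv
  obtain ⟨w, hw, hwv⟩ := Finset.mem_image.mp (h (Finset.mem_image_of_mem _ hv))
  exact hT.mem_of_reachable (SimpleGraph.ConnectedComponent.exact hwv) hw

open Classical in
theorem SimpleGraph.IsAdjClosed.two_mul_card_image_le {S : Finset V} (hS : G.IsAdjClosed S)
    (hiso : ∀ v : V, ∃ u : V, G.Adj v u) :
    2 * (S.image G.connectedComponentMk).card ≤ S.card := by
  refine Finset.mul_card_image_le_card S 2 fun c hc => ?_
  obtain ⟨v, hv, rfl⟩ := Finset.mem_image.mp hc
  obtain ⟨u, hu⟩ := hiso v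
  rw [← Finset.card_pair hu.ne]
  refine Finset.card_le_card fun w hw => ?_
  rcases Finset.mem_insert.mp hw with rfl | hw
  · simp [hv]
  · rw [Finset.mem_singleton.mp hw, Finset.mem_filter]
    exact ⟨hS hu hv, SimpleGraph.ConnectedComponent.sound hu.symm.reachable⟩

end ClosedSets

theorem Nat.choose_le_choose_of_le_half {n j r : ℕ} (hjr : j ≤ r) (hr : r ≤ n / 2) :
    n.choose j ≤ n.choose r := by
  induction r, hjr using Nat.le_induction with
  | base => exact le_rfl
  | succ k _ ih =>
    exact (ih (by omega)).trans (Nat.choose_le_succ_of_lt_half_left (by omega))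

/-- An antichain whose members have size at most `r ≤ n / 2`, over a ground set of size at most
`n`, has at most `n.choose r` members. -/
theorem IsAntichain.card_le_choose_of_card_le {α : Type*} [Fintype α] {𝒜 : Finset (Finset α)}
    (h𝒜 : IsAntichain (· ⊆ ·) (𝒜 : Set (Finset α))) {n r : ℕ} (hn : Fintype.card α ≤ n)
    (hr : r ≤ n / 2) (hcard : ∀ A ∈ 𝒜, A.card ≤ r) : 𝒜.card ≤ n.choose r := by
  have hpos : (0 : ℚ) < n.choose r := by
    exact_mod_cast Nat.choose_pos (hr.trans (Nat.div_le_self n 2))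
  have hle : ∀ A ∈ 𝒜, ((n.choose r : ℚ))⁻¹ ≤ (((Fintype.card α).choose A.card : ℕ) : ℚ)⁻¹ := by
    intro A hA
    have h0 : 0 < (Fintype.card α).choose A.card := Nat.choose_pos (Finset.card_le_univ A)
    have h1 : (Fintype.card α).choose A.card ≤ n.choose r :=
      (Nat.choose_le_choose _ hn).trans (Nat.choose_le_choose_of_le_half (hcard A hA) hr)
    gcongr
  have hlym := Finset.lubell_yamamoto_meshalkin_inequality_sum_inv_choose (𝕜 := ℚ) h𝒜
  have hsum := (Finset.sum_le_sum hle).trans hlym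
  rw [Finset.sum_const, nsmul_eq_mul, ← div_eq_mul_inv, div_le_one hpos] at hsum
  exact_mod_cast hsum

open Classical in
/-- Without isolated vertices, the `d`-sets closed under adjacency are unions of components of
size at least two, and form an antichain of sets of components. -/
theorem SimpleGraph.card_filter_isAdjClosed_le {V : Type*} [Fintype V] (G : SimpleGraph V)
    (hiso : ∀ v : V, ∃ u : V, G.Adj v u) {d : ℕ} (hd : 2 * d ≤ Fintype.card V) :
    ((Finset.powersetCard d Finset.univ).filter (fun S : Finset V => G.IsAdjClosed S)).card ≤
      (Fintype.card V / 2).choose (d / 2) := by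
  set F := (Finset.powersetCard d Finset.univ).filter (fun S : Finset V => G.IsAdjClosed S) with hF
  have hmem : ∀ S ∈ F, S.card = d ∧ G.IsAdjClosed S := by
    intro S hS
    simpa [hF, Finset.mem_powersetCard] using hS
  have heq : ∀ S ∈ F, ∀ T ∈ F,
      S.image G.connectedComponentMk ⊆ T.image G.connectedComponentMk → S = T := by
    intro S hS T hT h
    exact Finset.eq_of_subset_of_card_le ((hmem T hT).2.subset_of_image_subset h)
      ((hmem T hT).1.trans (hmem S hS).1.symm).le
  have hinj : Set.InjOn (fun S : Finset V => S.image G.connectedComponentMk) F :=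
    fun S hS T hT h => heq S hS T hT (Eq.subset h)
  rw [← Finset.card_image_of_injOn hinj]
  refine IsAntichain.card_le_choose_of_card_le ?_ ?_ (by omega) ?_
  · intro A hA B hB hne hAB
    obtain ⟨S, hS, rfl⟩ := Finset.mem_image.mp (Finset.mem_coe.mp hA)
    obtain ⟨T, hT, rfl⟩ := Finset.mem_image.mp (Finset.mem_coe.mp hB)
    exact hne (by rw [heq S hS T hT hAB])
  · have huniv : G.IsAdjClosed Finset.univ := fun _ v _ _ => Finset.mem_univ v
    have h := huniv.two_mul_card_image_le hiso
    rw [Finset.image_univ_of_surjective (f := G.connectedComponentMk) Quot.mk_surjective,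
      Finset.card_univ, Finset.card_univ] at h
    omega
  · intro A hA
    obtain ⟨S, hS, rfl⟩ := Finset.mem_image.mp hA
    have h := (hmem S hS).2.two_mul_card_image_le hiso
    rw [(hmem S hS).1] at h
    omega

theorem Equiv.Perm.card_filter_mem_iff_mem_le {V : Type*} [Fintype V] [DecidableEq V]
    (S Z : Finset V) (h : S.card = Z.card) :
    (Finset.univ.filter (fun π : Equiv.Perm V => ∀ v, v ∈ S ↔ π v ∈ Z)).card ≤
      Z.card.factorial * (Fintype.card V - Z.card).factorial := by
  have e₁ : {v // v ∈ S} ≃ {v // v ∈ Z} := Fintype.equivOfCardEq (by simpa using h)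
  have e₂ : {v // v ∉ S} ≃ {v // v ∉ Z} := Fintype.equivOfCardEq (by
    simp [Fintype.card_subtype_compl, h])
  have hcard : Fintype.card (({v // v ∈ S} ≃ {v // v ∈ Z}) × ({v // v ∉ S} ≃ {v // v ∉ Z})) =
      Z.card.factorial * (Fintype.card V - Z.card).factorial := by
    rw [Fintype.card_prod, Fintype.card_equiv e₁, Fintype.card_equiv e₂,
      Fintype.card_subtype_compl]
    simp [h]
  rw [← hcard, ← Fintype.card_subtype]
  refine Fintype.card_le_of_injective
    (fun π => (π.1.subtypeEquiv π.2, π.1.subtypeEquiv fun v => not_congr (π.2 v))) ?_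
  intro π σ hπσ
  obtain ⟨h₁, h₂⟩ := Prod.mk.inj hπσ
  ext v
  by_cases hv : v ∈ S
  · exact congrArg Subtype.val (DFunLike.congr_fun h₁ ⟨v, hv⟩)
  · exact congrArg Subtype.val (DFunLike.congr_fun h₂ ⟨v, hv⟩)


/-- Let `G` be an undirected graph on a vertex set `V` with `|V| = m` having
no isolated vertices, let `2 ≤ d ≤ m/2`, and `Z ⊆ V` with `|Z| = d`. Let `N` be the number
of permutations `π` of `V` such that the permuted graph `π(G)` (with edges `{π u, π v}` for
edges `{u, v}` of `G`) has no edge with one endpoint in `Z` and the other in `V ∖ Z`.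
Then `N · binom(m, d) ≤ binom(⌊m/2⌋, ⌊d/2⌋) · m!`. -/
theorem random_permutation_no_crossing_edge {V : Type*} [Fintype V] [DecidableEq V]
    {m : ℕ} (hm : Fintype.card V = m)
    (G : SimpleGraph V) [DecidableRel G.Adj]
    (hiso : ∀ v : V, ∃ u : V, G.Adj v u)
    {d : ℕ} (hd₁ : 2 ≤ d) (hd₂ : 2 * d ≤ m)
    (Z : Finset V) (hZ : Z.card = d) :
    (Finset.univ.filter (fun π : Equiv.Perm V =>
        ¬ ∃ u v : V, G.Adj u v ∧ π u ∈ Z ∧ π v ∉ Z)).card * Nat.choose m d ≤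
      Nat.choose (m / 2) (d / 2) * Nat.factorial m := by
  classical
  subst hm
  set P := Finset.univ.filter (fun π : Equiv.Perm V =>
    ¬ ∃ u v : V, G.Adj u v ∧ π u ∈ Z ∧ π v ∉ Z) with hP
  set F := (Finset.powersetCard d Finset.univ).filter (fun S : Finset V => G.IsAdjClosed S)
    with hF
  have hmaps : ∀ π ∈ P, Z.map π.symm.toEmbedding ∈ F := by
    intro π hπ
    simp only [hP, Finset.mem_filter, Finset.mem_univ, true_and] at hπ
    simp only [hF, Finset.mem_filter, Finset.mem_powersetCard_univ, Finset.card_map, hZ, true_and]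
    intro u v huv hu
    rw [Finset.mem_map_equiv, Equiv.symm_symm] at hu ⊢
    by_contra hv
    exact hπ ⟨u, v, huv, hu, hv⟩
  have hfiber : ∀ S ∈ F, (P.filter fun π => Z.map π.symm.toEmbedding = S).card ≤
      d.factorial * (Fintype.card V - d).factorial := by
    intro S hS
    simp only [hF, Finset.mem_filter, Finset.mem_powersetCard_univ] at hS
    have hle := Equiv.Perm.card_filter_mem_iff_mem_le S Z (hS.1.trans hZ.symm)
    rw [hZ] at hle
    refine (Finset.card_le_card fun π hπ => ?_).trans hle
    obtain ⟨-, rfl⟩ := Finset.mem_filter.mp hπ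
    simp [Finset.mem_map_equiv]
  have hPF := Finset.card_le_mul_card_image_of_maps_to hmaps _ hfiber
  have hFle := G.card_filter_isAdjClosed_le hiso hd₂
  calc P.card * (Fintype.card V).choose d
      ≤ d.factorial * (Fintype.card V - d).factorial * F.card * (Fintype.card V).choose d := by
        gcongr
    _ = F.card * ((Fintype.card V).choose d * d.factorial * (Fintype.card V - d).factorial) := by
        ring
    _ = F.card * (Fintype.card V).factorial := by
        rw [Nat.choose_mul_factorial_mul_factorial (by omega)]
    _ ≤ (Fintype.card V / 2).choose (d / 2) * (Fintype.card V).factorial := by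
        gcongr
end

section
/- For every fixed integer s ≥ 3 there exists a constant c > 0 such that for every m ≥ 1, every vertex set V with |V| = m, and all graphs G_1,…,G_s on V each having no isolated vertices, the number N of s-tuples (π_1,…,π_s) of permutations of V for which the union π_1(G_1) ∪ … ∪ π_s(G_s) is not a connected graph on V satisfies N·m^{s−2} ≤ c·(m!)^s. -/
open Finset

namespace SimpleGraph

variable {V : Type*}

/-- A set of vertices is saturated if no edge leaves it, i.e. if it is a union of connected
components. -/
def IsSaturated (G : SimpleGraph V) (S : Finset V) : Prop :=
  ∀ ⦃u v : V⦄, G.Adj u v → u ∈ S → v ∈ S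

theorem IsSaturated.mono {G H : SimpleGraph V} {S : Finset V} (hS : H.IsSaturated S)
    (h : G ≤ H) : G.IsSaturated S :=
  fun _ _ huv hu => hS (h huv) hu

theorem isSaturated_map_iff {G : SimpleGraph V} {π : Equiv.Perm V} {S : Finset V} :
    (G.map π).IsSaturated S ↔ G.IsSaturated (S.map π.symm.toEmbedding) := by
  simp only [IsSaturated, Finset.mem_map_equiv, Equiv.symm_symm]
  constructor
  · intro h u v huv hu
    exact h ((G.map_adj_apply (f := π.toEmbedding)).2 huv) (by simpa using hu)
  · rintro h _ _ ⟨-, u, v, huv, rfl, rfl⟩ hu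
    exact h huv (by simpa using hu)

/-- The saturated sets with `k` vertices. -/
noncomputable def saturatedSets [Fintype V] (G : SimpleGraph V) (k : ℕ) : Finset (Finset V) :=
  open Classical in {S ∈ powersetCard k univ | G.IsSaturated S}

theorem mem_saturatedSets [Fintype V] {G : SimpleGraph V} {k : ℕ} {S : Finset V} :
    S ∈ G.saturatedSets k ↔ #S = k ∧ G.IsSaturated S := by
  simp [saturatedSets, mem_powersetCard]

/-- A finite graph without isolated vertices has a set `A` of vertices such that every vertex has
a neighbour on the other side of the partition `(A, Aᶜ)`. -/
theorem exists_bidominating_set [Fintype V] (G : SimpleGraph V) (hG : ∀ v, ∃ u, G.Adj v u) :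
    ∃ A : Finset V, ∀ v, ∃ u, G.Adj v u ∧ (u ∈ A ↔ v ∉ A) := by
  classical
  obtain ⟨A, hA⟩ := (Set.toFinite {A : Finset V | G.IsIndepSet (A : Set V)}).exists_maximal
    ⟨∅, by simp⟩
  refine ⟨A, fun v => ?_⟩
  by_cases hv : v ∈ A
  · obtain ⟨u, hu⟩ := hG v
    refine ⟨u, hu, ?_⟩
    simpa [hv] using fun h => hA.prop (by simpa using hv) (by simpa using h) hu.ne hu
  · by_contra! hcon
    refine hv (hA.le_of_ge (y := insert v A) ?_ (subset_insert _ _) (mem_insert_self _ _))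
    simp only [Set.mem_ofPred_eq, coe_insert]
    intro x hx y hy hxy hadj
    rcases hx with rfl | hx <;> rcases hy with rfl | hy
    · exact hxy rfl
    · have := hcon y hadj
      simp_all
    · have := hcon x hadj.symm
      simp_all
    · exact hA.prop hx hy hxy hadj

theorem IsSaturated.eq_of_inter_eq [DecidableEq V] {G : SimpleGraph V} {B S T : Finset V}
    (hB : ∀ v ∉ B, ∃ u ∈ B, G.Adj v u) (hS : G.IsSaturated S) (hT : G.IsSaturated T)
    (h : S ∩ B = T ∩ B) : S = T := by
  have key : ∀ {S T : Finset V}, G.IsSaturated S → G.IsSaturated T → S ∩ B = T ∩ B →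
      S ⊆ T := by
    intro S T hS hT h v hv
    by_cases hvB : v ∈ B
    · exact (mem_inter.1 (h ▸ mem_inter.2 ⟨hv, hvB⟩)).1
    · obtain ⟨u, huB, huv⟩ := hB v hvB
      have hu : u ∈ T := (mem_inter.1 (h ▸ mem_inter.2 ⟨hS huv hv, huB⟩)).1
      exact hT huv.symm hu
  exact (key hS hT h).antisymm (key hT hS h.symm)

theorem card_saturatedSets_sq_le [Fintype V] (G : SimpleGraph V) (hG : ∀ v, ∃ u, G.Adj v u)
    (k : ℕ) : #(G.saturatedSets k) ^ 2 ≤ (k + 1) * (Fintype.card V).choose k := by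
  classical
  obtain ⟨A, hA⟩ := G.exists_bidominating_set hG
  have hA₁ : ∀ v ∉ A, ∃ u ∈ A, G.Adj v u := fun v hv => by
    obtain ⟨u, hu, hiff⟩ := hA v
    exact ⟨u, by tauto, hu⟩
  have hA₂ : ∀ v ∉ Aᶜ, ∃ u ∈ Aᶜ, G.Adj v u := fun v hv => by
    obtain ⟨u, hu, hiff⟩ := hA v
    rw [mem_compl, not_not] at hv
    exact ⟨u, by rw [mem_compl]; tauto, hu⟩
  set F := G.saturatedSets k with hF
  let fiber : ℕ → Finset (Finset V) := fun j => {S ∈ F | #(S ∩ A) = j}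
  have hsum : #F = ∑ j ∈ range (k + 1), #(fiber j) := by
    refine card_eq_sum_card_fiberwise fun S hS => ?_
    have := (mem_saturatedSets.1 hS).1
    have := card_le_card (inter_subset_left (s₁ := S) (s₂ := A))
    simp only [coe_range, Set.mem_Iio]
    omega
  have hinj : ∑ j ∈ range (k + 1), #(fiber j) ^ 2 ≤ (Fintype.card V).choose k := by
    simp_rw [sq, ← card_product]
    rw [← card_sigma, ← card_univ, ← card_powersetCard]
    refine card_le_card_of_injOn (fun x => (x.2.1 ∩ A) ∪ (x.2.2 ∩ Aᶜ)) ?_ ?_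
    · rintro ⟨j, S, T⟩ h
      simp only [coe_sigma, Set.mem_sigma_iff, mem_coe, mem_product, fiber, mem_filter, hF,
        mem_saturatedSets] at h
      obtain ⟨-, ⟨⟨hS, -⟩, hSj⟩, ⟨hT, -⟩, hTj⟩ := h
      have hdisj : Disjoint (S ∩ A) (T ∩ Aᶜ) :=
        disjoint_compl_right.mono inter_subset_right inter_subset_right
      have hsplit := card_inter_add_card_sdiff T A
      rw [sdiff_eq_inter_compl] at hsplit
      simp only [mem_coe, mem_powersetCard, subset_univ, true_and, card_union_of_disjoint hdisj]
      omega
    · rintro ⟨j, S, T⟩ h ⟨j', S', T'⟩ h' heq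
      simp only [coe_sigma, Set.mem_sigma_iff, mem_coe, mem_product, fiber, mem_filter, hF,
        mem_saturatedSets] at h h' heq
      have hS : S = S' := h.2.1.1.2.eq_of_inter_eq hA₁ h'.2.1.1.2 <| by
        ext v
        have := Finset.ext_iff.1 heq v
        simp only [mem_union, mem_inter, mem_compl] at this ⊢
        tauto
      have hT : T = T' := h.2.2.1.2.eq_of_inter_eq hA₂ h'.2.2.1.2 <| by
        ext v
        have := Finset.ext_iff.1 heq v
        simp only [mem_union, mem_inter, mem_compl] at this ⊢
        tauto
      obtain rfl : j = j' := by rw [← h.2.1.2, ← h'.2.1.2, hS]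
      rw [hS, hT]
  calc #F ^ 2 ≤ #(range (k + 1)) * ∑ j ∈ range (k + 1), #(fiber j) ^ 2 := by
        rw [hsum]; exact sq_sum_le_card_mul_sum_sq
    _ ≤ (k + 1) * (Fintype.card V).choose k := by
        rw [card_range]; gcongr

end SimpleGraph

/-- If `π` is a uniformly random permutation and `S` a `k`-set, then `π⁻¹(S)` is a uniformly
random `k`-set. -/
theorem Equiv.Perm.card_filter_map_symm_mem_mul_choose {V : Type*} [Fintype V] [DecidableEq V]
    {k : ℕ} {F : Finset (Finset V)} (hF : ∀ S ∈ F, #S = k) {S : Finset V} (hS : #S = k) :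
    #{π : Equiv.Perm V | S.map π.symm.toEmbedding ∈ F} * (Fintype.card V).choose k =
      #F * (Fintype.card V).factorial := by
  have hconst : ∀ T ∈ powersetCard k (univ : Finset V),
      #{π : Equiv.Perm V | T.map π.symm.toEmbedding ∈ F} =
        #{π : Equiv.Perm V | S.map π.symm.toEmbedding ∈ F} := by
    intro T hT
    have hST : #S = #T := by rw [hS, (mem_powersetCard.1 hT).2]
    let e : {x // x ∈ S} ≃ {x // x ∈ T} := Finset.equivOfCardEq hST
    let σ : Equiv.Perm V := e.extendSubtype
    have hσ : T.map σ.symm.toEmbedding = S := by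
      refine (eq_of_subset_of_card_le (fun v hv => ?_) ?_).symm
      · rw [mem_map_equiv, Equiv.symm_symm]
        exact e.extendSubtype_mem v hv
      · rw [card_map, hST]
    refine card_equiv (Equiv.mulLeft σ⁻¹) fun π => ?_
    have : S.map (σ⁻¹ * π).symm.toEmbedding = T.map π.symm.toEmbedding := by
      ext v
      rw [← hσ]
      simp [mem_map_equiv]
    simp [this]
  have hperm : ∀ π : Equiv.Perm V,
      #{T ∈ powersetCard k (univ : Finset V) | T.map π.symm.toEmbedding ∈ F} = #F := by
    intro π
    refine card_bij (fun T _ => T.map π.symm.toEmbedding) (by simp)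
      (fun _ _ _ _ h => map_injective _ h) fun T hT => ?_
    have hinv : (T.map π.toEmbedding).map π.symm.toEmbedding = T := by
      ext v
      simp [mem_map_equiv]
    refine ⟨T.map π.toEmbedding, ?_, ?_⟩
    · simp [mem_powersetCard, hF T hT, hinv, hT]
    · exact hinv
  calc _ = ∑ T ∈ powersetCard k (univ : Finset V),
        #{π : Equiv.Perm V | T.map π.symm.toEmbedding ∈ F} := by
        rw [sum_congr rfl hconst, sum_const, card_powersetCard, card_univ, smul_eq_mul, mul_comm]
    _ = ∑ π : Equiv.Perm V,
        #{T ∈ powersetCard k (univ : Finset V) | T.map π.symm.toEmbedding ∈ F} := by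
        simp_rw [card_filter]
        exact sum_comm
    _ = _ := by
        simp_rw [hperm]
        rw [sum_const, card_univ, Fintype.card_perm, smul_eq_mul, mul_comm]

namespace SimpleGraph

theorem card_isSaturated_map_le {V : Type*} [Fintype V] [DecidableEq V] {G : SimpleGraph V}
    (hG : ∀ v, ∃ u, G.Adj v u) (S : Finset V)
    [DecidablePred fun π : Equiv.Perm V => (G.map π.toEmbedding).IsSaturated S] :
    (#{π : Equiv.Perm V | (G.map π.toEmbedding).IsSaturated S} : ℝ) ≤
      √((#S + 1) / (Fintype.card V).choose #S) * (Fintype.card V).factorial := by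
  have hC : (0 : ℝ) < (Fintype.card V).choose #S := by
    exact_mod_cast Nat.choose_pos (card_le_univ S)
  have heq : #{π : Equiv.Perm V | (G.map π.toEmbedding).IsSaturated S} =
      #{π : Equiv.Perm V | S.map π.symm.toEmbedding ∈ G.saturatedSets #S} := by
    congr 1
    ext π
    simp [← isSaturated_map_iff, mem_saturatedSets]
  have hcount := Equiv.Perm.card_filter_map_symm_mem_mul_choose
    (F := G.saturatedSets #S) (fun T hT => (mem_saturatedSets.1 hT).1) (rfl : #S = #S)
  rw [← heq] at hcount
  have hsq := G.card_saturatedSets_sq_le hG #S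
  have hcount' := congrArg (Nat.cast : ℕ → ℝ) hcount
  have hsq' := (Nat.cast_le (α := ℝ)).2 hsq
  push_cast at hcount' hsq'
  rw [eq_div_iff hC.ne' |>.2 hcount', mul_div_right_comm]
  gcongr
  apply Real.le_sqrt_of_sq_le
  rw [div_pow, div_le_div_iff₀ (by positivity) hC]
  nlinarith

theorem exists_isSaturated_of_not_connected {V : Type*} [Fintype V] [Nonempty V]
    {G : SimpleGraph V} (hG : ∀ v, ∃ u, G.Adj v u) (h : ¬ G.Connected) :
    ∃ S : Finset V, G.IsSaturated S ∧ 2 ≤ #S ∧ #S ≤ Fintype.card V / 2 := by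
  classical
  have htwo : ∀ {S : Finset V} {v : V}, v ∈ S → G.IsSaturated S → 2 ≤ #S := by
    intro S v hv hS
    obtain ⟨u, hu⟩ := hG v
    exact one_lt_card.2 ⟨v, hv, u, hS hu hv, hu.ne⟩
  have hpre : ¬ G.Preconnected := fun hp => h ⟨hp⟩
  simp only [Preconnected, not_forall] at hpre
  obtain ⟨u, v, huv⟩ := hpre
  let S : Finset V := {w | G.Reachable u w}
  have hS : G.IsSaturated S := fun x y hxy hx => by
    simp only [S, mem_filter, mem_univ, true_and] at hx ⊢
    exact hx.trans hxy.reachable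
  have hSc : G.IsSaturated Sᶜ := fun x y hxy hx => by
    rw [mem_compl] at hx ⊢
    exact fun hy => hx (hS hxy.symm hy)
  have hu : u ∈ S := by simp [S]
  have hv : v ∈ Sᶜ := by simpa [S] using huv
  have hcard := card_add_card_compl S
  rcases le_total #S #Sᶜ with hle | hle
  · exact ⟨S, hS, htwo hu hS, by omega⟩
  · exact ⟨Sᶜ, hSc, htwo hv hSc, by omega⟩

/-- First moment bound over the saturated sets. -/
theorem card_not_connected_iSup_map_le {s : ℕ} (hs : 0 < s) {V : Type*} [Fintype V] [Nonempty V]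
    (G : Fin s → SimpleGraph V) (hG : ∀ i v, ∃ u, (G i).Adj v u) :
    (Nat.card {π : Fin s → Equiv.Perm V //
        ¬ (⨆ i : Fin s, (G i).map (π i).toEmbedding).Connected} : ℝ) ≤
      ∑ k ∈ Icc 2 (Fintype.card V / 2), (Fintype.card V).choose k *
        (√((k + 1) / (Fintype.card V).choose k) * (Fintype.card V).factorial) ^ s := by
  classical
  let bad (S : Finset V) : Finset (Fin s → Equiv.Perm V) :=
    Fintype.piFinset fun i => {π | ((G i).map π.toEmbedding).IsSaturated S}
  have hbad : ∀ S : Finset V, (#(bad S) : ℝ) ≤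
      (√((#S + 1) / (Fintype.card V).choose #S) * (Fintype.card V).factorial) ^ s := by
    intro S
    rw [Fintype.card_piFinset, Nat.cast_prod]
    refine (prod_le_prod (fun _ _ => by positivity)
      fun i _ => card_isSaturated_map_le (hG i) S).trans_eq ?_
    simp
  have hcover : Nat.card {π : Fin s → Equiv.Perm V //
      ¬ (⨆ i : Fin s, (G i).map (π i).toEmbedding).Connected} ≤
        #((Icc 2 (Fintype.card V / 2)).biUnion fun k => (powersetCard k univ).biUnion bad) := by
    rw [Nat.card_eq_fintype_card, Fintype.card_subtype]
    refine card_le_card fun π hπ => ?_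
    simp only [mem_filter, mem_univ, true_and] at hπ
    have hle (i : Fin s) : (G i).map (π i).toEmbedding ≤ ⨆ i, (G i).map (π i).toEmbedding :=
      le_iSup (fun i => (G i).map (π i).toEmbedding) i
    obtain ⟨S, hS, h2, hhalf⟩ := exists_isSaturated_of_not_connected (fun v => by
      obtain ⟨u, hu⟩ := hG ⟨0, hs⟩ ((π ⟨0, hs⟩).symm v)
      refine ⟨π ⟨0, hs⟩ u, hle ⟨0, hs⟩ ?_⟩
      simpa using ((G ⟨0, hs⟩).map_adj_apply (f := (π ⟨0, hs⟩).toEmbedding)).2 hu) hπ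
    simp only [mem_biUnion, mem_Icc, mem_powersetCard, bad, Fintype.mem_piFinset, mem_filter,
      mem_univ, true_and, subset_univ]
    exact ⟨#S, ⟨h2, hhalf⟩, S, rfl, fun i => hS.mono (hle i)⟩
  refine (Nat.cast_le.2 (hcover.trans card_biUnion_le)).trans ?_
  rw [Nat.cast_sum]
  refine sum_le_sum fun k _ => ?_
  refine (Nat.cast_le.2 card_biUnion_le).trans ?_
  rw [Nat.cast_sum]
  refine (sum_le_card_nsmul _ _ _ fun S hS => ?_).trans_eq
    (by rw [card_powersetCard, card_univ, nsmul_eq_mul])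
  obtain ⟨-, rfl⟩ := mem_powersetCard.1 hS
  exact hbad S

end SimpleGraph

theorem Nat.choose_le_choose_of_le_half_s14 {n a b : ℕ} (hab : a ≤ b) (hb : b ≤ n / 2) :
    n.choose a ≤ n.choose b := by
  induction b, hab using Nat.le_induction with
  | base => exact le_rfl
  | succ b _ ih =>
    exact (ih (by omega)).trans (Nat.choose_le_succ_of_lt_half_left (by omega))

theorem sq_le_four_mul_choose {m k : ℕ} (hk : 2 ≤ k) (hkm : k ≤ m / 2) :
    (m : ℝ) ^ 2 ≤ 4 * m.choose k := by
  have h : (m.choose 2 : ℝ) ≤ m.choose k := by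
    exact_mod_cast Nat.choose_le_choose_of_le_half_s14 hk hkm
  have hm : (4 : ℝ) ≤ m := by exact_mod_cast (by omega : 4 ≤ m)
  rw [Nat.cast_choose_two] at h
  nlinarith

theorem pow_seven_le_mul_choose {m k : ℕ} (hk : 7 ≤ k) (hkm : k ≤ m / 2) :
    (m : ℝ) ^ 7 ≤ 10 ^ 6 * m.choose k := by
  have h : (m.choose 7 : ℝ) ≤ m.choose k := by
    exact_mod_cast Nat.choose_le_choose_of_le_half_s14 hk hkm
  have hpow := Nat.pow_le_choose (α := ℝ) 7 m
  have hm : (m : ℝ) / 2 ≤ (m + 1 - 7 : ℕ) := by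
    rw [Nat.cast_sub (by omega)]
    have : (14 : ℝ) ≤ m := by exact_mod_cast (by omega : 14 ≤ m)
    push_cast
    linarith
  have hpow' : ((m : ℝ) / 2) ^ 7 ≤ ((m + 1 - 7 : ℕ) : ℝ) ^ 7 := by gcongr
  rw [show (Nat.factorial 7 : ℝ) = 5040 by norm_num [Nat.factorial]] at hpow
  rw [div_pow] at hpow'
  have : (0 : ℝ) ≤ m.choose k := by positivity
  linarith

theorem choose_mul_sqrt_pow_mul_le {s m k : ℕ} (hs : 3 ≤ s) (hk : 2 ≤ k) (hkm : k ≤ m / 2) :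
    (m.choose k : ℝ) * √((k + 1) / m.choose k) ^ s * m ^ (s - 2) ≤
      1000 ^ (s - 2) * ((if k ∈ Icc 2 6 then 7 else 0) + 1 / m) := by
  obtain ⟨t, rfl⟩ : ∃ t, s = t + 2 := ⟨s - 2, by omega⟩
  have hC : (0 : ℝ) < m.choose k := by exact_mod_cast Nat.choose_pos (by omega)
  have hm : (1 : ℝ) ≤ m := by exact_mod_cast (by omega : 1 ≤ m)
  set q := √((k + 1) / m.choose k : ℝ) with hq
  have hq0 : 0 ≤ q := Real.sqrt_nonneg _
  have hq2 : m.choose k * q ^ 2 = (k + 1 : ℝ) := by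
    rw [hq, Real.sq_sqrt (by positivity)]
    field_simp
  have hterm : (m.choose k : ℝ) * q ^ (t + 2) * m ^ t = (k + 1) * (q * m) ^ t := by
    rw [← hq2]; ring
  rw [Nat.add_sub_cancel, hterm]
  by_cases hk6 : k ≤ 6
  · have hk7 : (k + 1 : ℝ) ≤ 7 := by exact_mod_cast (by omega : k + 1 ≤ 7)
    have hqm : q * m ≤ 1000 := by
      refine abs_le_of_sq_le_sq' ?_ (by norm_num) |>.2
      have := sq_le_four_mul_choose hk hkm
      calc (q * m) ^ 2 = q ^ 2 * m ^ 2 := by ring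
        _ ≤ q ^ 2 * (4 * m.choose k) := by gcongr
        _ = 4 * (k + 1) := by rw [← hq2]; ring
        _ ≤ 1000 ^ 2 := by linarith
    rw [if_pos (mem_Icc.2 ⟨hk, hk6⟩)]
    calc (k + 1 : ℝ) * (q * m) ^ t ≤ 7 * 1000 ^ t := by gcongr
      _ ≤ 1000 ^ t * (7 + 1 / m) := by
        rw [mul_comm]
        gcongr
        simp
  · have hkm' : (k + 1 : ℝ) ≤ m := by exact_mod_cast (by omega : k + 1 ≤ m)
    have hqm : q * m ≤ 1000 / m ^ 2 := by
      rw [le_div_iff₀ (by positivity)]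
      refine abs_le_of_sq_le_sq' ?_ (by norm_num) |>.2
      have := pow_seven_le_mul_choose (by omega) hkm
      refine le_of_mul_le_mul_right ?_ (by positivity : (0 : ℝ) < m)
      calc (q * m * m ^ 2) ^ 2 * m = q ^ 2 * m ^ 7 := by ring
        _ ≤ q ^ 2 * (10 ^ 6 * m.choose k) := by gcongr
        _ = 10 ^ 6 * (k + 1) := by rw [← hq2]; ring
        _ ≤ 1000 ^ 2 * m := by linarith
    rw [if_neg (by simp; omega), zero_add]
    calc (k + 1 : ℝ) * (q * m) ^ t ≤ m * (1000 / m ^ 2) ^ t := by gcongr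
      _ = 1000 ^ t * (m * (1 / m ^ 2) ^ t) := by rw [div_pow, div_pow]; ring
      _ ≤ 1000 ^ t * (m * (1 / m ^ 2) ^ 1) := by
        gcongr 1000 ^ t * (m * ?_)
        refine pow_le_pow_of_le_one (by positivity) ?_ (by omega)
        rw [div_le_one (by positivity)]
        exact one_le_pow₀ hm
      _ = 1000 ^ t * (1 / m) := by field_simp


/-- For every fixed integer `s ≥ 3` there exists a constant `c > 0` such
that for every `m ≥ 1`, every vertex set `V` with `|V| = m`, and all graphs `G₁, …, G_s` on
`V` each having no isolated vertices, the number `N` of `s`-tuples `(π₁, …, π_s)` of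
permutations of `V` for which the union `π₁(G₁) ∪ … ∪ π_s(G_s)` is not connected satisfies
`N · m^(s−2) ≤ c · (m!)^s`. -/
theorem union_of_random_permutations_connected (s : ℕ) (hs : 3 ≤ s) :
    ∃ c : ℝ, 0 < c ∧
      ∀ (m : ℕ), 1 ≤ m → ∀ (V : Type) [Fintype V], Fintype.card V = m →
        ∀ G : Fin s → SimpleGraph V, (∀ i : Fin s, ∀ v : V, ∃ u : V, (G i).Adj v u) →
          (Nat.card {π : Fin s → Equiv.Perm V //
              ¬ (⨆ i : Fin s, (G i).map (π i).toEmbedding).Connected} : ℝ) *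
              (m : ℝ) ^ (s - 2) ≤
            c * (Nat.factorial m : ℝ) ^ s := by
  refine ⟨1000 ^ (s - 2) * 36, by positivity, ?_⟩
  rintro m hm V _ rfl G hG
  have : Nonempty V := Fintype.card_pos_iff.1 hm
  set m := Fintype.card V
  have hm' : (0 : ℝ) < m := by exact_mod_cast hm
  calc _ ≤ (∑ k ∈ Icc 2 (m / 2), m.choose k *
        (√((k + 1) / m.choose k) * m.factorial) ^ s) * (m : ℝ) ^ (s - 2) := by
        gcongr
        exact SimpleGraph.card_not_connected_iSup_map_le (by omega) G hG
    _ = (∑ k ∈ Icc 2 (m / 2), (m.choose k : ℝ) * √((k + 1) / m.choose k) ^ s * m ^ (s - 2)) *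
        (m.factorial : ℝ) ^ s := by
        rw [sum_mul, sum_mul]
        refine sum_congr rfl fun k _ => ?_
        rw [mul_pow]
        ring
    _ ≤ (∑ k ∈ Icc 2 (m / 2),
        1000 ^ (s - 2) * ((if k ∈ Icc 2 6 then 7 else 0) + 1 / (m : ℝ))) *
        (m.factorial : ℝ) ^ s := by
        refine mul_le_mul_of_nonneg_right (sum_le_sum fun k hk => ?_) (by positivity)
        exact choose_mul_sqrt_pow_mul_le hs (mem_Icc.1 hk).1 (mem_Icc.1 hk).2
    _ ≤ _ := by
        rw [← mul_sum, sum_add_distrib, ← sum_filter, sum_const, sum_const, nsmul_eq_mul,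
          nsmul_eq_mul]
        have hsmall : (#{k ∈ Icc 2 (m / 2) | k ∈ Icc 2 6} : ℝ) ≤ 5 := by
          exact_mod_cast (card_le_card fun k hk => (mem_filter.1 hk).2 :
            #{k ∈ Icc 2 (m / 2) | k ∈ Icc 2 6} ≤ #(Icc 2 6))
        have hall : (#(Icc 2 (m / 2)) : ℝ) * (1 / m) ≤ 1 := by
          rw [mul_one_div, div_le_one hm', Nat.card_Icc]
          exact_mod_cast (by omega)
        gcongr
        linarith
end

section
/- For every integer constant c ≥ 0 there exists n0 such that for every n ≥ n0 and every integer k with |2k − n| ≤ c, there is a (k+1)-uniform hypergraph on an n-element vertex set of size at most 6·C(n, k+1, k) having connected restrictions. -/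
/-- `F` is a covering system witnessing `C(n, r, k)`: a family of `r`-element subsets of an
`n`-element set such that every `k`-element subset is contained in at least one member. -/
def IsCoveringSystem (n r k : ℕ) (F : Finset (Finset (Fin n))) : Prop :=
  (∀ e ∈ F, e.card = r) ∧ ∀ s : Finset (Fin n), s.card = k → ∃ e ∈ F, s ⊆ e

/-- The covering number `C(n, r, k)`: the smallest size of a family of `r`-element subsets
of an `n`-element set such that every `k`-element subset is contained in at least one
member of the family. -/
noncomputable def coverNum (n r k : ℕ) : ℕ :=
  sInf {m | ∃ F : Finset (Finset (Fin n)), IsCoveringSystem n r k F ∧ F.card = m}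

/-- The edge relation of the graph `G(H, A)` on the vertex set `X ∖ A`: its edges are the
`2`-element sets `e ∖ A` for hyperedges `e ∈ H` with `A ⊆ e`. -/
def GEdge {n : ℕ} (H : Finset (Finset (Fin n))) (A : Finset (Fin n)) (u v : Fin n) : Prop :=
  u ≠ v ∧ ∃ e ∈ H, A ⊆ e ∧ e \ A = {u, v}

/-- A `(k+1)`-uniform hypergraph `H` has connected restrictions if for every
`(k−1)`-element set `A ⊆ X`, the graph `G(H, A)` is connected on the vertex set `X ∖ A`. -/
def ConnectedRestrictions {n : ℕ} (k : ℕ) (H : Finset (Finset (Fin n))) : Prop :=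
  ∀ A : Finset (Fin n), A.card + 1 = k →
    ∀ u ∉ A, ∀ v ∉ A, Relation.ReflTransGen (GEdge H A) u v

open Finset

open scoped Classical in
/-- In a graph where every vertex of `W` has a neighbour, a union of components inside `W` is
determined by at most half as many representatives. -/
theorem sq_card_adj_closed_le {α : Type*} (G : SimpleGraph α) (W : Finset α)
    (hW : ∀ x ∈ W, ∃ y, G.Adj x y) (c : ℕ) :
    (#{U ∈ W.powersetCard c | ∀ u ∈ U, ∀ v, G.Adj u v → v ∈ U}) ^ 2 ≤
      ∑ j ∈ range (c + 1), (#W).choose j := by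
  set S := {U ∈ W.powersetCard c | ∀ u ∈ U, ∀ v, G.Adj u v → v ∈ U} with hS
  have hmem : ∀ {U}, U ∈ S ↔ (U ⊆ W ∧ #U = c) ∧ ∀ u ∈ U, ∀ v, G.Adj u v → v ∈ U := by
    simp [hS, mem_powersetCard]
  have hreach : ∀ U ∈ S, ∀ u ∈ U, ∀ v, G.Reachable u v → v ∈ U := by
    intro U hU u hu v huv
    rw [SimpleGraph.reachable_iff_reflTransGen] at huv
    induction huv with
    | refl => exact hu
    | tail _ h ih => exact (hmem.1 hU).2 _ ih _ h
  let r : α → α := fun x => (G.connectedComponentMk x).out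
  have hr : ∀ x, G.Reachable (r x) x := fun x =>
    SimpleGraph.ConnectedComponent.exact (Quot.out_eq (G.connectedComponentMk x))
  have hr' : ∀ {x y}, G.Reachable x y → r x = r y := by
    intro x y h
    simp only [r, SimpleGraph.ConnectedComponent.sound h]
  let m : α → α := fun x => if h : ∃ y, G.Adj x y then h.choose else x
  have hm : ∀ x ∈ W, G.Adj x (m x) := by
    intro x hx
    simp only [m, dif_pos (hW x hx)]
    exact (hW x hx).choose_spec
  let R : Finset α → Finset α := fun U => U.filter fun x => r x = x
  have hRW : ∀ U ∈ S, R U ⊆ W := fun U hU => (filter_subset _ _).trans (hmem.1 hU).1.1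
  have hmr : ∀ x ∈ W, r x = x → r (m x) = x := fun x hx h =>
    (hr' (hm x hx).reachable.symm).trans h
  have hRU : ∀ U ∈ S, ∀ x, x ∈ U ↔ r x ∈ R U := by
    intro U hU x
    simp only [R, mem_filter]
    constructor
    · exact fun hx => ⟨hreach U hU x hx _ (hr x).symm, hr' (hr x)⟩
    · exact fun hx => hreach U hU _ hx.1 _ (hr x)
  have hRinj : ∀ U ∈ S, ∀ U' ∈ S, R U = R U' → U = U' := by
    intro U hU U' hU' h
    ext x
    rw [hRU U hU, hRU U' hU', h]
  have hmU : ∀ U ∈ S, (R U).image m ⊆ U := by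
    intro U hU y hy
    obtain ⟨x, hx, rfl⟩ := mem_image.1 hy
    exact (hmem.1 hU).2 x (mem_filter.1 hx).1 _ (hm x (hRW U hU hx))
  have hmnot : ∀ U ∈ S, ∀ y ∈ (R U).image m, r y ≠ y := by
    intro U hU y hy h
    obtain ⟨x, hx, rfl⟩ := mem_image.1 hy
    rw [hmr x (hRW U hU hx) (mem_filter.1 hx).2] at h
    exact (hm x (hRW U hU hx)).ne h
  have hminj : ∀ U ∈ S, Set.InjOn m (R U) := by
    intro U hU x hx y hy h
    rw [← hmr x (hRW U hU hx) (mem_filter.1 hx).2, h, hmr y (hRW U hU hy) (mem_filter.1 hy).2]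
  have hcard : ∀ U ∈ S, 2 * #(R U) ≤ c := by
    intro U hU
    have hd : Disjoint (R U) ((R U).image m) := by
      rw [disjoint_left]
      exact fun x hx hx' => hmnot U hU x hx' (mem_filter.1 hx).2
    have := card_le_card (union_subset (filter_subset (fun x => r x = x) U) (hmU U hU))
    rw [card_union_of_disjoint hd, card_image_of_injOn (hminj U hU), (hmem.1 hU).1.2] at this
    omega
  have hrec : ∀ U ∈ S, ∀ U' ∈ S, (R U ∪ (R U').image m).filter (fun x => r x = x) = R U := by
    intro U hU U' hU'
    rw [filter_union, filter_false_of_mem (hmnot U' hU'), union_empty, filter_filter]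
    simp [R]
  have hrec' : ∀ U ∈ S, ∀ U' ∈ S,
      (R U ∪ (R U').image m).filter (fun x => r x ≠ x) = (R U').image m := by
    intro U hU U' hU'
    rw [filter_union, filter_true_of_mem (hmnot U' hU'), filter_false_of_mem, empty_union]
    exact fun x hx h => h (mem_filter.1 hx).2
  have hback : ∀ U ∈ S, ((R U).image m).image r = R U := by
    intro U hU
    rw [image_image]
    refine (image_congr fun x hx => ?_).trans image_id
    exact hmr x (hRW U hU hx) (mem_filter.1 hx).2
  rw [sq, ← card_product]
  have hT : #((range (c + 1)).biUnion fun j => W.powersetCard j) ≤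
      ∑ j ∈ range (c + 1), (#W).choose j :=
    card_biUnion_le.trans_eq (sum_congr rfl fun j _ => card_powersetCard j W)
  refine le_trans (card_le_card_of_injOn (fun p => R p.1 ∪ (R p.2).image m) ?_ ?_) hT
  · rintro ⟨U, U'⟩ h
    obtain ⟨hU, hU'⟩ := mem_product.1 h
    simp only [coe_biUnion, Set.mem_iUnion, mem_coe, mem_range, mem_powersetCard]
    refine ⟨_, ?_, union_subset (hRW U hU) ((hmU U' hU').trans (hmem.1 hU').1.1), rfl⟩
    have h1 := card_union_le (R U) ((R U').image m)
    have h2 : #((R U').image m) ≤ #(R U') := card_image_le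
    have h3 := hcard U hU
    have h4 := hcard U' hU'
    omega
  · rintro ⟨U, U'⟩ h ⟨V, V'⟩ h' heq
    obtain ⟨hU, hU'⟩ := mem_product.1 h
    obtain ⟨hV, hV'⟩ := mem_product.1 h'
    simp only at heq
    have e1 : R U = R V := by rw [← hrec U hU U' hU', heq, hrec V hV V' hV']
    have e2 : (R U').image m = (R V').image m := by
      rw [← hrec' U hU U' hU', heq, hrec' V hV V' hV']
    have e3 : R U' = R V' := by rw [← hback U' hU', e2, hback V' hV']
    rw [hRinj U hU V hV e1, hRinj U' hU' V' hV' e3]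

/-- The graph `G(H, A)`, with the vertices of `A` isolated. -/
def restrictionGraph {n : ℕ} (H : Finset (Finset (Fin n))) (A : Finset (Fin n)) :
    SimpleGraph (Fin n) where
  Adj := GEdge H A
  symm := ⟨fun u v ⟨hne, e, he, hA, h⟩ => ⟨hne.symm, e, he, hA, h.trans (pair_comm u v)⟩⟩
  loopless := ⟨fun _ h => h.1 rfl⟩

/-- `U` is a union of connected components of `G(H, A)`. -/
def EdgeClosed {n : ℕ} (H : Finset (Finset (Fin n))) (A U : Finset (Fin n)) : Prop :=
  ∀ u ∈ U, ∀ v, GEdge H A u v → v ∈ U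

theorem GEdge.symm {n : ℕ} {H : Finset (Finset (Fin n))} {A : Finset (Fin n)} {u v : Fin n}
    (h : GEdge H A u v) : GEdge H A v u :=
  (restrictionGraph H A).symm.symm _ _ h

theorem GEdge.notMem_right {n : ℕ} {H : Finset (Finset (Fin n))} {A : Finset (Fin n)}
    {u v : Fin n} (h : GEdge H A u v) : v ∉ A := by
  obtain ⟨-, e, -, -, he⟩ := h
  have : v ∈ e \ A := by simp [he]
  exact (mem_sdiff.1 this).2

theorem GEdge.mono {n : ℕ} {H H' : Finset (Finset (Fin n))} (hH : H ⊆ H') {A : Finset (Fin n)}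
    {u v : Fin n} (h : GEdge H A u v) : GEdge H' A u v := by
  obtain ⟨hne, e, he, h⟩ := h
  exact ⟨hne, e, hH he, h⟩

theorem IsCoveringSystem.exists_gEdge {n a : ℕ} {F : Finset (Finset (Fin n))}
    (hF : IsCoveringSystem n (a + 2) (a + 1) F) {A : Finset (Fin n)} (hA : #A = a)
    {u : Fin n} (hu : u ∉ A) : ∃ v, GEdge F A u v := by
  obtain ⟨e, he, hs⟩ := hF.2 (insert u A) (by rw [card_insert_of_notMem hu, hA])
  have hAe : A ⊆ e := (subset_insert u A).trans hs
  have h2 : #(e \ A) = 2 := by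
    rw [card_sdiff_of_subset hAe, hF.1 e he, hA]
    omega
  have hue : u ∈ e \ A := mem_sdiff.2 ⟨hs (mem_insert_self u A), hu⟩
  obtain ⟨v, hv⟩ := card_eq_one.1 (show #((e \ A).erase u) = 1 by rw [card_erase_of_mem hue, h2])
  refine ⟨v, ?_, e, he, hAe, ?_⟩
  · rintro rfl
    have : u ∈ (e \ A).erase u := by simp [hv]
    exact notMem_erase _ _ this
  · rw [← insert_erase hue, hv]

/-- The system of all sets whose image under `σ` lies in `F`. -/
def pullSystem {n : ℕ} (σ : Equiv.Perm (Fin n)) (F : Finset (Finset (Fin n))) :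
    Finset (Finset (Fin n)) :=
  F.map (Equiv.finsetCongr σ.symm).toEmbedding

theorem mem_pullSystem {n : ℕ} {σ : Equiv.Perm (Fin n)} {F : Finset (Finset (Fin n))}
    {e : Finset (Fin n)} : e ∈ pullSystem σ F ↔ e.map σ.toEmbedding ∈ F := by
  rw [pullSystem, mem_map_equiv]
  simp

theorem card_pullSystem {n : ℕ} (σ : Equiv.Perm (Fin n)) (F : Finset (Finset (Fin n))) :
    #(pullSystem σ F) = #F :=
  card_map _

theorem pullSystem_mul {n : ℕ} (σ π : Equiv.Perm (Fin n)) (F : Finset (Finset (Fin n))) :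
    pullSystem (σ * π) F = pullSystem π (pullSystem σ F) := by
  ext e
  simp only [mem_pullSystem, map_map]
  rfl

theorem gEdge_pullSystem {n : ℕ} {σ : Equiv.Perm (Fin n)} {F : Finset (Finset (Fin n))}
    {A : Finset (Fin n)} {u v : Fin n} :
    GEdge (pullSystem σ F) A u v ↔ GEdge F (A.map σ.toEmbedding) (σ u) (σ v) := by
  have key : ∀ e : Finset (Fin n),
      e.map σ.toEmbedding \ A.map σ.toEmbedding = {σ u, σ v} ↔ e \ A = {u, v} := by
    intro e
    rw [← Finset.map_sdiff, show ({σ u, σ v} : Finset (Fin n)) = map σ.toEmbedding {u, v} by simp,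
      map_inj]
  unfold GEdge
  rw [σ.injective.ne_iff]
  refine and_congr_right fun _ => ⟨?_, ?_⟩
  · rintro ⟨e, he, hA, h⟩
    exact ⟨_, mem_pullSystem.1 he, map_subset_map.2 hA, (key e).2 h⟩
  · rintro ⟨e, he, hA, h⟩
    obtain ⟨e, rfl⟩ := (Equiv.finsetCongr σ).surjective e
    rw [Equiv.finsetCongr_apply] at he hA h
    exact ⟨e, mem_pullSystem.2 he, map_subset_map.1 hA, (key e).1 h⟩

theorem edgeClosed_pullSystem {n : ℕ} {σ : Equiv.Perm (Fin n)} {F : Finset (Finset (Fin n))}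
    {A U : Finset (Fin n)} :
    EdgeClosed (pullSystem σ F) A U ↔
      EdgeClosed F (A.map σ.toEmbedding) (U.map σ.toEmbedding) := by
  have hmem : ∀ x, σ x ∈ U.map σ.toEmbedding ↔ x ∈ U := fun x => by simp
  refine ⟨fun h u hu v huv => ?_, fun h u hu v huv => ?_⟩
  · obtain ⟨u, rfl⟩ := σ.surjective u
    obtain ⟨v, rfl⟩ := σ.surjective v
    exact (hmem v).2 (h u ((hmem u).1 hu) v (gEdge_pullSystem.2 huv))
  · exact (hmem v).1 (h _ ((hmem u).2 hu) _ (gEdge_pullSystem.1 huv))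

theorem IsCoveringSystem.pull {n r k : ℕ} {F : Finset (Finset (Fin n))}
    (hF : IsCoveringSystem n r k F) (σ : Equiv.Perm (Fin n)) :
    IsCoveringSystem n r k (pullSystem σ F) := by
  refine ⟨fun e he => ?_, fun s hs => ?_⟩
  · rw [← hF.1 _ (mem_pullSystem.1 he), card_map]
  · obtain ⟨e, he, hse⟩ := hF.2 (s.map σ.toEmbedding) (by rw [card_map, hs])
    obtain ⟨e, rfl⟩ := (Equiv.finsetCongr σ).surjective e
    exact ⟨e, mem_pullSystem.2 he, map_subset_map.1 hse⟩

/-- Permutations act transitively on pairs of disjoint sets of given sizes. -/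
theorem exists_perm_map_eq_map_eq {α : Type*} [Fintype α] [DecidableEq α] {A U A' U' : Finset α}
    (hd : Disjoint A U) (hd' : Disjoint A' U') (hA : #A = #A') (hU : #U = #U') :
    ∃ π : Equiv.Perm α, A.map π.toEmbedding = A' ∧ U.map π.toEmbedding = U' := by
  let label : Finset α → Finset α → α → Fin 3 :=
    fun A U x => if x ∈ A then 0 else if x ∈ U then 1 else 2
  have h0 : ∀ A U x, label A U x = 0 ↔ x ∈ A := by
    intro A U x
    simp only [label]
    split_ifs <;> simp_all
  have h1 : ∀ A U, Disjoint A U → ∀ x, label A U x = 1 ↔ x ∈ U := by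
    intro A U h x
    simp only [label]
    split_ifs with hx
    · simp [disjoint_left.1 h hx]
    · simp_all
    · simp_all
  have h2 : ∀ A U x, label A U x = 2 ↔ x ∈ (A ∪ U)ᶜ := by
    intro A U x
    simp only [label]
    split_ifs <;> simp_all
  have hcard : ∀ i, Nonempty ({x // label A U x = i} ≃ {x // label A' U' x = i}) := by
    intro i
    rw [← Fintype.card_eq, Fintype.card_subtype, Fintype.card_subtype]
    fin_cases i
    · simpa [h0] using hA
    · simpa [h1 _ _ hd, h1 _ _ hd'] using hU
    · simp only [Fin.reduceFinMk, h2, filter_mem_eq_inter, univ_inter, card_compl,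
        card_union_of_disjoint hd, card_union_of_disjoint hd', hA, hU]
  let e : Equiv.Perm α := Equiv.ofFiberEquiv fun i => (hcard i).some
  have he : ∀ x, label A' U' (e x) = label A U x := fun x => Equiv.ofFiberEquiv_map _ x
  refine ⟨e, ?_, ?_⟩
  · ext y
    rw [mem_map_equiv, ← h0 A U, ← he, h0, e.apply_symm_apply]
  · ext y
    rw [mem_map_equiv, ← h1 A U hd, ← he, h1 _ _ hd', e.apply_symm_apply]

/-- The pairs of a set `A` of size `a` and a set `U` of size `c` avoiding it. -/
def disjointPairs (n a c : ℕ) : Finset (Finset (Fin n) × Finset (Fin n)) :=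
  {p ∈ powersetCard a univ ×ˢ powersetCard c univ | Disjoint p.1 p.2}

theorem mem_disjointPairs {n a c : ℕ} {p : Finset (Fin n) × Finset (Fin n)} :
    p ∈ disjointPairs n a c ↔ (#p.1 = a ∧ #p.2 = c) ∧ Disjoint p.1 p.2 := by
  simp [disjointPairs, mem_powersetCard]

theorem sum_disjointPairs {n a c : ℕ} (f : Finset (Fin n) → Finset (Fin n) → ℕ) :
    ∑ p ∈ disjointPairs n a c, f p.1 p.2 =
      ∑ A ∈ powersetCard a univ, ∑ U ∈ powersetCard c Aᶜ, f A U := by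
  refine sum_finset_product' _ _ _ fun p => ?_
  rw [mem_disjointPairs, mem_powersetCard, mem_powersetCard, subset_compl_comm,
    subset_compl_iff_disjoint_right]
  simp only [subset_univ, true_and]
  tauto

theorem card_disjointPairs (n a c : ℕ) :
    #(disjointPairs n a c) = n.choose a * (n - a).choose c := by
  rw [card_eq_sum_ones, sum_disjointPairs fun _ _ => 1]
  rw [sum_congr rfl (g := fun _ => (n - a).choose c)]
  · simp [card_powersetCard]
  · intro A hA
    rw [← card_eq_sum_ones, card_powersetCard, card_compl, (mem_powersetCard.1 hA).2,
      Fintype.card_fin]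

theorem choose_le_choose_of_two_mul_le {N c j : ℕ} (hj : j ≤ c) (hc : 2 * c ≤ N) :
    N.choose j ≤ N.choose c := by
  induction c, hj using Nat.le_induction with
  | base => exact le_rfl
  | succ m hm ih => exact (ih (by omega)).trans (Nat.choose_le_succ_of_lt_half_left (by omega))

theorem sum_range_choose_le {N c : ℕ} (hc : 2 * c ≤ N) :
    ∑ j ∈ range (c + 1), N.choose j ≤ (c + 1) * N.choose c :=
  (sum_le_card_nsmul _ _ _ fun _ hj =>
    choose_le_choose_of_two_mul_le (Nat.lt_succ_iff.1 (mem_range.1 hj)) hc).trans_eq (by simp)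

open scoped Classical in
theorem IsCoveringSystem.card_edgeClosed_le {n a c : ℕ} {F : Finset (Finset (Fin n))}
    (hF : IsCoveringSystem n (a + 2) (a + 1) F) (hc : 2 * c ≤ n - a) :
    #{p ∈ disjointPairs n a c | EdgeClosed F p.1 p.2} ≤
      n.choose a * Nat.sqrt ((c + 1) * (n - a).choose c) := by
  rw [card_filter, sum_disjointPairs fun A U => if EdgeClosed F A U then 1 else 0]
  refine (sum_le_card_nsmul _ _ (Nat.sqrt ((c + 1) * (n - a).choose c)) fun A hA => ?_).trans_eq
    (by simp [card_powersetCard])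
  have hA' := (mem_powersetCard.1 hA).2
  have hcard : #Aᶜ = n - a := by rw [card_compl, hA', Fintype.card_fin]
  have hle := sq_card_adj_closed_le (restrictionGraph F A) Aᶜ
    (fun x hx => hF.exists_gEdge hA' (mem_compl.1 hx)) c
  rw [hcard] at hle
  rw [← card_filter, Nat.le_sqrt']
  refine le_trans (le_of_eq ?_) (hle.trans (sum_range_choose_le hc))
  congr!

open scoped Classical in
/-- The number of permutations `σ` for which `U` is a union of components in the restriction of
the pullback of `F` to `A`. -/
noncomputable def closedCount {n : ℕ} (F : Finset (Finset (Fin n))) (A U : Finset (Fin n)) : ℕ :=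
  #{σ : Equiv.Perm (Fin n) | EdgeClosed (pullSystem σ F) A U}

theorem closedCount_map {n : ℕ} (F : Finset (Finset (Fin n))) (A U : Finset (Fin n))
    (π : Equiv.Perm (Fin n)) :
    closedCount F (A.map π.toEmbedding) (U.map π.toEmbedding) = closedCount F A U := by
  classical
  unfold closedCount
  refine card_equiv (Equiv.mulRight π) fun σ => ?_
  simp only [mem_filter, mem_univ, true_and, Equiv.coe_mulRight]
  rw [pullSystem_mul, edgeClosed_pullSystem (σ := π)]

theorem closedCount_eq {n a c : ℕ} (F : Finset (Finset (Fin n)))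
    {p q : Finset (Fin n) × Finset (Fin n)} (hp : p ∈ disjointPairs n a c)
    (hq : q ∈ disjointPairs n a c) : closedCount F p.1 p.2 = closedCount F q.1 q.2 := by
  rw [mem_disjointPairs] at hp hq
  obtain ⟨π, h1, h2⟩ := exists_perm_map_eq_map_eq hp.2 hq.2 (hp.1.1.trans hq.1.1.symm)
    (hp.1.2.trans hq.1.2.symm)
  rw [← h1, ← h2, closedCount_map]

theorem IsCoveringSystem.closedCount_sq_le {n a c : ℕ} {F : Finset (Finset (Fin n))}
    (hF : IsCoveringSystem n (a + 2) (a + 1) F) (hc : 2 * c ≤ n - a)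
    {p : Finset (Fin n) × Finset (Fin n)} (hp : p ∈ disjointPairs n a c) :
    closedCount F p.1 p.2 ^ 2 * (n - a).choose c ≤ (n.factorial) ^ 2 * (c + 1) := by
  classical
  have hsum : #(disjointPairs n a c) * closedCount F p.1 p.2 ≤
      n.factorial * (n.choose a * Nat.sqrt ((c + 1) * (n - a).choose c)) := by
    calc #(disjointPairs n a c) * closedCount F p.1 p.2
        = ∑ q ∈ disjointPairs n a c, closedCount F q.1 q.2 := by
          rw [sum_congr rfl fun q hq => closedCount_eq F hq hp, sum_const, smul_eq_mul]
      _ = ∑ σ : Equiv.Perm (Fin n),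
            #{q ∈ disjointPairs n a c | EdgeClosed (pullSystem σ F) q.1 q.2} := by
          simp only [closedCount, card_filter]
          exact sum_comm
      _ ≤ ∑ _σ : Equiv.Perm (Fin n), n.choose a * Nat.sqrt ((c + 1) * (n - a).choose c) :=
          sum_le_sum fun σ _ => (hF.pull σ).card_edgeClosed_le hc
      _ = _ := by simp [Fintype.card_perm]
  have hpos : 0 < #(disjointPairs n a c) := card_pos.2 ⟨p, hp⟩
  rw [card_disjointPairs] at hsum hpos
  have hpos1 : 0 < n.choose a := Nat.pos_of_mul_pos_right hpos
  have hpos2 : 0 < (n - a).choose c := Nat.pos_of_mul_pos_left hpos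
  set C := (n - a).choose c
  set g := closedCount F p.1 p.2
  have h1 : C * g ≤ n.factorial * Nat.sqrt ((c + 1) * C) :=
    Nat.le_of_mul_le_mul_left (by linarith) hpos1
  refine Nat.le_of_mul_le_mul_left ?_ hpos2
  calc C * (g ^ 2 * C) = (C * g) ^ 2 := by ring
    _ ≤ (n.factorial * Nat.sqrt ((c + 1) * C)) ^ 2 := Nat.pow_le_pow_left h1 2
    _ = n.factorial ^ 2 * Nat.sqrt ((c + 1) * C) ^ 2 := by ring
    _ ≤ n.factorial ^ 2 * ((c + 1) * C) := Nat.mul_le_mul_left _ (Nat.sqrt_le' _)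
    _ = C * (n.factorial ^ 2 * (c + 1)) := by ring

theorem exists_edgeClosed_of_not_connected {n : ℕ} {H : Finset (Finset (Fin n))}
    {A : Finset (Fin n)} (hiso : ∀ u ∉ A, ∃ v, GEdge H A u v) {u v : Fin n} (hu : u ∉ A)
    (hv : v ∉ A) (huv : ¬ Relation.ReflTransGen (GEdge H A) u v) :
    ∃ U, Disjoint A U ∧ 2 ≤ #U ∧ 2 * #U ≤ #Aᶜ ∧ EdgeClosed H A U := by
  classical
  have hlarge : ∀ U ⊆ Aᶜ, EdgeClosed H A U → U.Nonempty → 2 ≤ #U := by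
    rintro U hUA hU ⟨x, hx⟩
    obtain ⟨y, hxy⟩ := hiso x (mem_compl.1 (hUA hx))
    exact one_lt_card.2 ⟨x, hx, y, hU x hx y hxy, hxy.1⟩
  let U : Finset (Fin n) := {x ∈ Aᶜ | Relation.ReflTransGen (GEdge H A) u x}
  have hUA : U ⊆ Aᶜ := filter_subset _ _
  have hU : EdgeClosed H A U := fun x hx y hxy =>
    mem_filter.2 ⟨mem_compl.2 hxy.notMem_right, (mem_filter.1 hx).2.tail hxy⟩
  have hV : EdgeClosed H A (Aᶜ \ U) := fun x hx y hxy =>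
    mem_sdiff.2 ⟨mem_compl.2 hxy.notMem_right, fun hy => (mem_sdiff.1 hx).2 (hU y hy x hxy.symm)⟩
  have hsum := card_sdiff_add_card_eq_card hUA
  by_cases h : 2 * #U ≤ #Aᶜ
  · exact ⟨U, disjoint_left.2 fun x hx hxU => mem_compl.1 (hUA hxU) hx,
      hlarge U hUA hU ⟨u, mem_filter.2 ⟨mem_compl.2 hu, .refl⟩⟩, h, hU⟩
  · exact ⟨Aᶜ \ U, disjoint_left.2 fun x hx hxU => mem_compl.1 (sdiff_subset hxU) hx,
      hlarge _ sdiff_subset hV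
        ⟨v, mem_sdiff.2 ⟨mem_compl.2 hv, fun h => huv (mem_filter.1 h).2⟩⟩, by omega, hV⟩

open scoped Classical in
/-- The sets `A` of size `a` for which `G(H, A)` is disconnected. -/
noncomputable def disconnectedSets {n : ℕ} (a : ℕ) (H : Finset (Finset (Fin n))) :
    Finset (Finset (Fin n)) :=
  {A ∈ powersetCard a univ |
    ¬ ∀ u ∉ A, ∀ v ∉ A, Relation.ReflTransGen (GEdge H A) u v}

/-- The union of the pullbacks of `F` under a family of permutations. -/
def unionPull {n m : ℕ} (F : Finset (Finset (Fin n))) (τ : Fin m → Equiv.Perm (Fin n)) :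
    Finset (Finset (Fin n)) :=
  univ.biUnion fun i => pullSystem (τ i) F

theorem card_unionPull_le {n m : ℕ} (F : Finset (Finset (Fin n)))
    (τ : Fin m → Equiv.Perm (Fin n)) : #(unionPull F τ) ≤ m * #F := by
  refine card_biUnion_le.trans_eq ?_
  simp [card_pullSystem]

theorem pullSystem_subset_unionPull {n m : ℕ} (F : Finset (Finset (Fin n)))
    (τ : Fin m → Equiv.Perm (Fin n)) (i : Fin m) : pullSystem (τ i) F ⊆ unionPull F τ :=
  subset_biUnion_of_mem (fun i => pullSystem (τ i) F) (mem_univ i)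

open scoped Classical in
theorem IsCoveringSystem.card_disconnectedSets_le {n a m : ℕ} [NeZero m]
    {F : Finset (Finset (Fin n))} (hF : IsCoveringSystem n (a + 2) (a + 1) F)
    (τ : Fin m → Equiv.Perm (Fin n)) :
    #(disconnectedSets a (unionPull F τ)) ≤ ∑ c ∈ Icc 2 ((n - a) / 2),
      #{p ∈ disjointPairs n a c | ∀ i, EdgeClosed (pullSystem (τ i) F) p.1 p.2} := by
  refine le_trans (card_le_card ?_) ((card_image_le (f := Prod.fst)).trans card_biUnion_le)
  intro A hA
  obtain ⟨hA, hdis⟩ := mem_filter.1 hA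
  have hA' := (mem_powersetCard.1 hA).2
  push Not at hdis
  obtain ⟨u, hu, v, hv, huv⟩ := hdis
  have hiso : ∀ u ∉ A, ∃ v, GEdge (unionPull F τ) A u v := fun u hu => by
    obtain ⟨v, hv⟩ := (hF.pull (τ 0)).exists_gEdge hA' hu
    exact ⟨v, hv.mono (pullSystem_subset_unionPull F τ 0)⟩
  obtain ⟨U, hd, h2, hhalf, hU⟩ := exists_edgeClosed_of_not_connected hiso hu hv huv
  rw [card_compl, hA', Fintype.card_fin] at hhalf
  refine mem_image.2 ⟨(A, U), mem_biUnion.2 ⟨#U, mem_Icc.2 ⟨h2, by omega⟩, ?_⟩, rfl⟩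
  exact mem_filter.2 ⟨mem_disjointPairs.2 ⟨⟨hA', rfl⟩, hd⟩, fun i x hx y hxy =>
    hU x hx y (hxy.mono (pullSystem_subset_unionPull F τ i))⟩

theorem IsCoveringSystem.sum_card_disconnectedSets_le {n a m : ℕ} [NeZero m]
    {F : Finset (Finset (Fin n))} (hF : IsCoveringSystem n (a + 2) (a + 1) F) :
    ∑ τ : Fin m → Equiv.Perm (Fin n), #(disconnectedSets a (unionPull F τ)) ≤
      ∑ c ∈ Icc 2 ((n - a) / 2), ∑ p ∈ disjointPairs n a c, closedCount F p.1 p.2 ^ m := by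
  classical
  refine (sum_le_sum fun τ _ => hF.card_disconnectedSets_le τ).trans_eq ?_
  rw [sum_comm]
  refine sum_congr rfl fun c _ => ?_
  simp only [card_filter]
  rw [sum_comm]
  refine sum_congr rfl fun p _ => ?_
  rw [← card_filter, closedCount, ← Fintype.card_piFinset_const]
  congr 1
  ext τ
  simp [Fintype.mem_piFinset]

theorem choose_mul_pow_five_le {N c : ℕ} {q : ℝ} (hN : 46080 ≤ N) (hc2 : 2 ≤ c)
    (hc : 2 * c ≤ N) (h : q ^ 2 * N.choose c ≤ c + 1) :
    N.choose c * q ^ 5 ≤ (if c ≤ 5 then 2000 / (N : ℝ) ^ 3 else 0) + 1 / (N : ℝ) ^ 4 := by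
  have hN' : (46080 : ℝ) ≤ N := by exact_mod_cast hN
  have hN0 : (0 : ℝ) < N := by linarith
  set X : ℝ := N.choose c * q ^ 5 with hX
  have hXC : X ^ 2 * (N.choose c : ℝ) ^ 3 ≤ ((c : ℝ) + 1) ^ 5 := by
    calc X ^ 2 * (N.choose c : ℝ) ^ 3 = (q ^ 2 * N.choose c) ^ 5 := by rw [hX]; ring
      _ ≤ _ := by gcongr
  have hchoose : ∀ r, r ≤ c → ((N : ℝ) / 2) ^ r / r.factorial ≤ N.choose c := by
    intro r hr
    calc ((N : ℝ) / 2) ^ r / r.factorial ≤ ((N + 1 - r : ℕ) : ℝ) ^ r / r.factorial := by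
          have : (N : ℝ) / 2 ≤ ((N + 1 - r : ℕ) : ℝ) := by
            rw [div_le_iff₀ two_pos]
            exact_mod_cast (by omega : N ≤ (N + 1 - r) * 2)
          gcongr
      _ ≤ N.choose r := Nat.pow_le_choose r N
      _ ≤ N.choose c := by exact_mod_cast choose_le_choose_of_two_mul_le hr hc
  split_ifs with h5
  · refine le_add_of_le_of_nonneg ?_ (by positivity)
    have h2 : (N : ℝ) ^ 2 / 8 ≤ N.choose c := by
      refine le_of_eq_of_le ?_ (hchoose 2 hc2)
      norm_num [Nat.factorial]
      ring
    have h6 : ((c : ℝ) + 1) ^ 5 ≤ 6 ^ 5 := by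
      have : (c : ℝ) ≤ 5 := by exact_mod_cast h5
      gcongr
      linarith
    rw [le_div_iff₀ (by positivity)]
    refine abs_le_of_sq_le_sq' ?_ (by norm_num) |>.2
    have : X ^ 2 * ((N : ℝ) ^ 2 / 8) ^ 3 ≤ X ^ 2 * (N.choose c : ℝ) ^ 3 := by gcongr
    have e : X ^ 2 * ((N : ℝ) ^ 2 / 8) ^ 3 = (X * (N : ℝ) ^ 3) ^ 2 / 512 := by ring
    linarith
  · rw [zero_add, le_div_iff₀ (by positivity)]
    refine abs_le_of_sq_le_sq' ?_ (by norm_num) |>.2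
    have h6 := hchoose 6 (by omega)
    have e6 : ((N : ℝ) / 2) ^ 6 / (6 : ℕ).factorial = (N : ℝ) ^ 6 / 46080 := by
      norm_num [Nat.factorial]
      ring
    rw [e6] at h6
    have hcN : ((c : ℝ) + 1) ^ 5 ≤ (N : ℝ) ^ 5 := by
      have : (c : ℝ) + 1 ≤ N := by exact_mod_cast (by omega : c + 1 ≤ N)
      gcongr
    have h1 : X ^ 2 * ((N : ℝ) ^ 6 / 46080) ^ 3 ≤ X ^ 2 * (N.choose c : ℝ) ^ 3 := by gcongr
    have h3 : (46080 : ℝ) ^ 3 ≤ (N : ℝ) ^ 3 := by gcongr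
    have h4 : (N : ℝ) ^ 3 ≤ (N : ℝ) ^ 5 := pow_le_pow_right₀ (by linarith) (by norm_num)
    refine le_of_mul_le_mul_right ?_ (by positivity : 0 < (N : ℝ) ^ 10)
    calc (X * (N : ℝ) ^ 4) ^ 2 * (N : ℝ) ^ 10
        = X ^ 2 * ((N : ℝ) ^ 6 / 46080) ^ 3 * 46080 ^ 3 := by ring
      _ ≤ (N : ℝ) ^ 5 * (N : ℝ) ^ 5 := by
          gcongr
          · exact h1.trans (hXC.trans hcN)
          · exact h3.trans h4
      _ = 1 ^ 2 * (N : ℝ) ^ 10 := by ring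

theorem sum_Icc_ite_le {N : ℕ} (hN : 0 < N) :
    ∑ c ∈ Icc 2 (N / 2), ((if c ≤ 5 then 2000 / (N : ℝ) ^ 3 else 0) + 1 / (N : ℝ) ^ 4) ≤
      8001 / (N : ℝ) ^ 3 := by
  have hN' : (0 : ℝ) < N := by exact_mod_cast hN
  rw [sum_add_distrib, ← sum_filter, sum_const, sum_const, nsmul_eq_mul, nsmul_eq_mul]
  have h1 : (#{c ∈ Icc 2 (N / 2) | c ≤ 5} : ℝ) ≤ 4 := by
    have : #{c ∈ Icc 2 (N / 2) | c ≤ 5} ≤ #(Icc 2 5) := card_le_card fun x hx => by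
      simp only [mem_filter, mem_Icc] at hx ⊢
      omega
    exact_mod_cast this
  have h2 : (#(Icc 2 (N / 2)) : ℝ) ≤ N := by
    rw [Nat.card_Icc]
    exact_mod_cast (by omega : N / 2 + 1 - 2 ≤ N)
  calc _ ≤ 4 * (2000 / (N : ℝ) ^ 3) + N * (1 / (N : ℝ) ^ 4) := by gcongr
    _ = 8001 / (N : ℝ) ^ 3 := by
      field_simp
      norm_num

theorem IsCoveringSystem.exists_card_disconnectedSets_le {n a : ℕ} {F : Finset (Finset (Fin n))}
    (hF : IsCoveringSystem n (a + 2) (a + 1) F) (hN : 46080 ≤ n - a) :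
    ∃ τ : Fin 5 → Equiv.Perm (Fin n),
      #(disconnectedSets a (unionPull F τ)) * (n - a) ^ 3 ≤ 8001 * n.choose a := by
  set N := n - a with hNdef
  have hN0 : (0 : ℝ) < N := by exact_mod_cast (by omega : 0 < N)
  have hf : (0 : ℝ) < n.factorial := by exact_mod_cast n.factorial_pos
  have hpair : ∀ c ∈ Icc 2 (N / 2),
      ((∑ p ∈ disjointPairs n a c, closedCount F p.1 p.2 ^ 5 : ℕ) : ℝ) ≤
        n.choose a * (n.factorial : ℝ) ^ 5 *
          ((if c ≤ 5 then 2000 / (N : ℝ) ^ 3 else 0) + 1 / (N : ℝ) ^ 4) := by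
    intro c hc
    obtain ⟨hc2, hcN⟩ := mem_Icc.1 hc
    rcases (disjointPairs n a c).eq_empty_or_nonempty with h | ⟨p, hp⟩
    · rw [h, sum_empty, Nat.cast_zero]
      split_ifs <;> positivity
    · have hsq : (closedCount F p.1 p.2 : ℝ) ^ 2 * N.choose c ≤ (n.factorial : ℝ) ^ 2 * (c + 1) := by
        exact_mod_cast hF.closedCount_sq_le (c := c) (by omega) hp
      rw [sum_congr rfl fun q hq => by rw [closedCount_eq F hq hp], sum_const,
        card_disjointPairs, smul_eq_mul, ← hNdef]
      set g : ℝ := (closedCount F p.1 p.2 : ℝ) with hg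
      have := choose_mul_pow_five_le (q := g / n.factorial) hN hc2 (by omega) (by
        rw [div_pow, div_mul_eq_mul_div, div_le_iff₀ (by positivity)]
        linarith)
      calc ((n.choose a * N.choose c * closedCount F p.1 p.2 ^ 5 : ℕ) : ℝ)
          = n.choose a * (n.factorial : ℝ) ^ 5 * (N.choose c * (g / n.factorial) ^ 5) := by
            push_cast
            rw [← hg]
            field_simp
        _ ≤ _ := by gcongr
  have hcard : Fintype.card (Fin 5 → Equiv.Perm (Fin n)) = n.factorial ^ 5 := by
    simp [Fintype.card_perm]
  have htotal : ∑ τ : Fin 5 → Equiv.Perm (Fin n), (#(disconnectedSets a (unionPull F τ)) : ℝ) ≤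
      ∑ _τ : Fin 5 → Equiv.Perm (Fin n), n.choose a * (8001 / (N : ℝ) ^ 3) := by
    calc ∑ τ : Fin 5 → Equiv.Perm (Fin n), (#(disconnectedSets a (unionPull F τ)) : ℝ)
        ≤ ∑ c ∈ Icc 2 (N / 2),
            ((∑ p ∈ disjointPairs n a c, closedCount F p.1 p.2 ^ 5 : ℕ) : ℝ) := by
          exact_mod_cast hF.sum_card_disconnectedSets_le (m := 5)
      _ ≤ _ := sum_le_sum hpair
      _ ≤ n.choose a * (n.factorial : ℝ) ^ 5 * (8001 / (N : ℝ) ^ 3) := by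
          rw [← mul_sum]
          gcongr
          exact sum_Icc_ite_le (by omega)
      _ = _ := by
          rw [sum_const, card_univ, hcard, nsmul_eq_mul]
          push_cast
          ring
  obtain ⟨τ, -, hτ⟩ := exists_le_of_sum_le univ_nonempty htotal
  refine ⟨τ, ?_⟩
  rw [← mul_div_assoc, le_div_iff₀ (by positivity)] at hτ
  have : (#(disconnectedSets a (unionPull F τ)) * N ^ 3 : ℝ) ≤ 8001 * n.choose a := by linarith
  exact_mod_cast this

/-- Adding a star to each disconnected restriction makes all restrictions connected. -/
theorem exists_superset_connectedRestrictions {n a : ℕ} (ha : a < n) (H : Finset (Finset (Fin n)))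
    (hH : ∀ e ∈ H, #e = a + 2) :
    ∃ H' : Finset (Finset (Fin n)), (∀ e ∈ H', #e = a + 2) ∧
      #H' ≤ #H + #(disconnectedSets a H) * (n - a - 1) ∧ ConnectedRestrictions (a + 1) H' := by
  classical
  have hroot : ∀ A : Finset (Fin n), ∃ r, #A = a → r ∉ A := by
    intro A
    by_cases hA : #A = a
    · obtain ⟨r, hr⟩ : ∃ r, r ∉ A := by
        by_contra! h
        rw [eq_univ_of_forall h, card_univ, Fintype.card_fin] at hA
        omega
      exact ⟨r, fun _ => hr⟩
    · exact ⟨⟨0, by omega⟩, fun h => absurd h hA⟩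
  choose r hr using hroot
  let star : Finset (Fin n) → Finset (Finset (Fin n)) := fun A =>
    (Aᶜ.erase (r A)).image fun v => insert (r A) (insert v A)
  have hB : ∀ A ∈ disconnectedSets a H, #A = a := fun A hA =>
    (mem_powersetCard.1 (mem_filter.1 hA).1).2
  refine ⟨H ∪ (disconnectedSets a H).biUnion star, ?_, ?_, ?_⟩
  · intro e he
    rcases mem_union.1 he with he | he
    · exact hH e he
    · obtain ⟨A, hA, he⟩ := mem_biUnion.1 he
      obtain ⟨v, hv, rfl⟩ := mem_image.1 he
      obtain ⟨hvr, hvA⟩ := mem_erase.1 hv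
      rw [card_insert_of_notMem, card_insert_of_notMem (mem_compl.1 hvA), hB A hA]
      rw [mem_insert]
      exact not_or.2 ⟨hvr.symm, hr A (hB A hA)⟩
  · refine (card_union_le _ _).trans (Nat.add_le_add_left ?_ _)
    refine card_biUnion_le_card_mul _ _ _ fun A hA => card_image_le.trans_eq ?_
    rw [card_erase_of_mem (mem_compl.2 (hr A (hB A hA))), card_compl, hB A hA, Fintype.card_fin]
  · intro A hA u hu v hv
    have hA' : #A = a := by omega
    by_cases hbad : A ∈ disconnectedSets a H
    · have hadj : ∀ x ∉ A, x ≠ r A →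
          GEdge (H ∪ (disconnectedSets a H).biUnion star) A (r A) x := by
        intro x hx hxr
        refine ⟨hxr.symm, insert (r A) (insert x A), mem_union_right _ (mem_biUnion.2 ⟨A, hbad,
          mem_image.2 ⟨x, mem_erase.2 ⟨hxr, mem_compl.2 hx⟩, rfl⟩⟩),
          (subset_insert _ _).trans (subset_insert _ _), ?_⟩
        rw [insert_sdiff_of_notMem _ (hr A hA'), insert_sdiff_of_notMem _ hx, sdiff_self]
        rfl
      have hfrom : ∀ x ∉ A, Relation.ReflTransGen
          (GEdge (H ∪ (disconnectedSets a H).biUnion star) A) (r A) x := by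
        intro x hx
        by_cases hxr : x = r A
        · exact hxr ▸ .refl
        · exact .single (hadj x hx hxr)
      have hto : Relation.ReflTransGen
          (GEdge (H ∪ (disconnectedSets a H).biUnion star) A) u (r A) := by
        by_cases hur : u = r A
        · exact hur ▸ .refl
        · exact .single (hadj u hu hur).symm
      exact hto.trans (hfrom v hv)
    · have hconn : ∀ u ∉ A, ∀ v ∉ A, Relation.ReflTransGen (GEdge H A) u v := by
        by_contra h
        exact hbad (mem_filter.2 ⟨mem_powersetCard.2 ⟨subset_univ _, hA'⟩, h⟩)
      exact Relation.ReflTransGen.mono (fun _ _ h => h.mono subset_union_left) _ _ (hconn u hu v hv)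

theorem IsCoveringSystem.choose_le {n k : ℕ} {F : Finset (Finset (Fin n))}
    (hF : IsCoveringSystem n (k + 1) k F) : n.choose k ≤ #F * (k + 1) := by
  calc n.choose k = #(powersetCard k (univ : Finset (Fin n))) := by simp [card_powersetCard]
    _ ≤ #(F.biUnion fun e => powersetCard k e) := card_le_card fun s hs => by
        obtain ⟨e, he, hse⟩ := hF.2 s (mem_powersetCard.1 hs).2
        exact mem_biUnion.2 ⟨e, he, mem_powersetCard.2 ⟨hse, (mem_powersetCard.1 hs).2⟩⟩
    _ ≤ #F * (k + 1) := card_biUnion_le_card_mul _ _ _ fun e he => by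
        rw [card_powersetCard, hF.1 e he, Nat.choose_succ_self_right]

theorem exists_isCoveringSystem_card_eq_coverNum {n r k : ℕ} (hk : k ≤ r) (hr : r ≤ n) :
    ∃ F : Finset (Finset (Fin n)), IsCoveringSystem n r k F ∧ #F = coverNum n r k := by
  refine Nat.sInf_mem (s := {m | ∃ F : Finset (Finset (Fin n)),
    IsCoveringSystem n r k F ∧ F.card = m}) ⟨_, powersetCard r univ, ⟨fun e he =>
      (mem_powersetCard.1 he).2, fun s hs => ?_⟩, rfl⟩
  obtain ⟨e, hse, -, he⟩ := exists_subsuperset_card_eq (subset_univ s) (n := r) (by omega)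
    (by simpa using hr)
  exact ⟨e, mem_powersetCard.2 ⟨subset_univ e, he⟩, hse⟩

/-- For every integer constant `c ≥ 0` there exists `n₀` such that for every
`n ≥ n₀` and every integer `k` with `|2k − n| ≤ c`, there is a `(k+1)`-uniform hypergraph
on an `n`-element vertex set of size at most `6 · C(n, k+1, k)` having connected
restrictions. -/
theorem exists_small_hypergraph_connectedRestrictions :
    ∀ c : ℕ, ∃ n₀ : ℕ, ∀ n : ℕ, n₀ ≤ n → ∀ k : ℕ, |2 * (k : ℤ) - (n : ℤ)| ≤ (c : ℤ) →
      ∃ H : Finset (Finset (Fin n)),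
        (∀ e ∈ H, e.card = k + 1) ∧
        H.card ≤ 6 * coverNum n (k + 1) k ∧
        ConnectedRestrictions k H := by
  intro c
  refine ⟨3 * c + 100000, fun n hn k hk => ?_⟩
  obtain ⟨hk1, hk2⟩ := abs_le.1 hk
  obtain ⟨a, rfl⟩ : ∃ a, k = a + 1 := ⟨k - 1, by omega⟩
  obtain ⟨F, hF, hFcard⟩ := exists_isCoveringSystem_card_eq_coverNum
    (Nat.le_succ (a + 1)) (by omega : a + 1 + 1 ≤ n)
  obtain ⟨τ, hτ⟩ := IsCoveringSystem.exists_card_disconnectedSets_le hF (by omega)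
  obtain ⟨H, hunif, hcard, hconn⟩ := exists_superset_connectedRestrictions (by omega : a < n)
    (unionPull F τ) fun e he => by
      obtain ⟨i, -, he⟩ := mem_biUnion.1 he
      exact (hF.pull (τ i)).1 e he
  refine ⟨H, hunif, hcard.trans ?_, hconn⟩
  rw [← hFcard]
  have hchoose := hF.choose_le
  have hsucc := Nat.choose_succ_right_eq n a
  have hunion := card_unionPull_le F τ
  obtain ⟨N, hN⟩ : ∃ N, N = n - a := ⟨_, rfl⟩
  have hNc : a + 2 ≤ 2 * N := by omega
  have hN0 : 32004 ≤ N := by omega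
  rw [← hN] at hτ hsucc ⊢
  set b := #(disconnectedSets a (unionPull F τ))
  have hpatch : b * (N - 1) ≤ #F := by
    refine Nat.le_of_mul_le_mul_left ?_ (by positivity : 0 < N ^ 4)
    calc N ^ 4 * (b * (N - 1)) = b * N ^ 3 * (N * (N - 1)) := by ring
      _ ≤ 8001 * n.choose a * (N * (N - 1)) := Nat.mul_le_mul_right _ hτ
      _ = 8001 * (n.choose (a + 1) * (a + 1)) * (N - 1) := by rw [hsucc]; ring
      _ ≤ 8001 * (#F * (a + 1 + 1) * (a + 1)) * (N - 1) := by gcongr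
      _ = 8001 * (a + 2) * (a + 1) * (N - 1) * #F := by ring
      _ ≤ 8001 * (2 * N) * (2 * N) * N * #F := by
          gcongr
          · omega
          · omega
      _ = 32004 * N ^ 3 * #F := by ring
      _ ≤ N * N ^ 3 * #F := by gcongr
      _ = N ^ 4 * #F := by ring
  omega
end
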